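/- A polynomial h ∈ ℂ[λ₁,…,λₙ,q₁,…,qₙ,p₁,…,pₙ] satisfies {Fᵢ, h} ∈ J for every i = 1,…,n if and only if there exists b ∈ ℂ[λ₁,…,λₙ] with h − b ∈ J, where Fᵢ = qᵢpᵢ + λᵢ and J = (F₁,…,Fₙ). (This instantiates, for the deformation of the example of Section 2.2, the claim of Section 3.2 that H⁰ of the relative Lagrange complex is identified with the functions pulled back from the parameter space.) -/

import Mathlib

open MvPolynomial

/-- The relative Poisson bracket on ℂ[λ₁,…,λₙ,q₁,…,qₙ,p₁,…,pₙ], taken in the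
variables `(q,p)` only: the variable `Sum.inl i` is the parameter `λᵢ`,
`Sum.inr (Sum.inl i)` is `qᵢ` and `Sum.inr (Sum.inr i)` is `pᵢ`. -/
noncomputable def relPoissonBracket (n : ℕ)
    (f g : MvPolynomial (Fin n ⊕ (Fin n ⊕ Fin n)) ℂ) :
    MvPolynomial (Fin n ⊕ (Fin n ⊕ Fin n)) ℂ :=
  ∑ i : Fin n,
    (pderiv (Sum.inr (Sum.inl i)) f * pderiv (Sum.inr (Sum.inr i)) g -
      pderiv (Sum.inr (Sum.inr i)) f * pderiv (Sum.inr (Sum.inl i)) g)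

/-- The Euler-type derivation `pᵢ ∂/∂pᵢ - qᵢ ∂/∂qᵢ`, the Hamiltonian field of `qᵢpᵢ + λᵢ`. -/
noncomputable def hamiltonianDerivation (n : ℕ) (i : Fin n) :
    Derivation ℂ (MvPolynomial (Fin n ⊕ (Fin n ⊕ Fin n)) ℂ)
      (MvPolynomial (Fin n ⊕ (Fin n ⊕ Fin n)) ℂ) :=
  (X (Sum.inr (Sum.inr i)) : MvPolynomial (Fin n ⊕ (Fin n ⊕ Fin n)) ℂ) •
      pderiv (Sum.inr (Sum.inr i)) -
    (X (Sum.inr (Sum.inl i)) : MvPolynomial (Fin n ⊕ (Fin n ⊕ Fin n)) ℂ) •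
      pderiv (Sum.inr (Sum.inl i))

theorem hamiltonianDerivation_apply (n : ℕ) (i : Fin n)
    (f : MvPolynomial (Fin n ⊕ (Fin n ⊕ Fin n)) ℂ) :
    hamiltonianDerivation n i f =
      X (Sum.inr (Sum.inr i)) * pderiv (Sum.inr (Sum.inr i)) f -
        X (Sum.inr (Sum.inl i)) * pderiv (Sum.inr (Sum.inl i)) f := rfl

theorem relPoissonBracket_eq_hamiltonianDerivation (n : ℕ) (i : Fin n)
    (h : MvPolynomial (Fin n ⊕ (Fin n ⊕ Fin n)) ℂ) :
    relPoissonBracket n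
        (X (Sum.inr (Sum.inl i)) * X (Sum.inr (Sum.inr i)) + X (Sum.inl i)) h =
      hamiltonianDerivation n i h := by
  rw [relPoissonBracket, Finset.sum_eq_single i]
  · simp [hamiltonianDerivation_apply, pderiv_X]
  · intro j _ hj
    simp [pderiv_X, hj.symm]
  · simp

theorem coeff_X_mul_pderiv {σ R : Type*} [CommSemiring R] (s : σ) (f : MvPolynomial σ R)
    (m : σ →₀ ℕ) : coeff m (X s * pderiv s f) = m s * coeff m f := by
  classical
  induction f using MvPolynomial.induction_on' with
  | monomial u a =>
    rw [X_mul_pderiv_monomial, coeff_smul, coeff_monomial, nsmul_eq_mul]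
    split_ifs with hu <;> simp [hu]
  | add f g hf hg => rw [map_add, mul_add, coeff_add, hf, hg, coeff_add, mul_add]

theorem coeff_hamiltonianDerivation (n : ℕ) (i : Fin n)
    (f : MvPolynomial (Fin n ⊕ (Fin n ⊕ Fin n)) ℂ) (m : Fin n ⊕ (Fin n ⊕ Fin n) →₀ ℕ) :
    coeff m (hamiltonianDerivation n i f) =
      ((m (Sum.inr (Sum.inr i)) : ℂ) - m (Sum.inr (Sum.inl i))) * coeff m f := by
  rw [hamiltonianDerivation_apply, coeff_sub, coeff_X_mul_pderiv, coeff_X_mul_pderiv, sub_mul]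

theorem hamiltonianDerivation_rename_inl (n : ℕ) (i : Fin n) (b : MvPolynomial (Fin n) ℂ) :
    hamiltonianDerivation n i (rename Sum.inl b) = 0 := by
  induction b using MvPolynomial.induction_on with
  | C a => rw [rename_C, derivation_C]
  | add f g hf hg => rw [map_add, map_add, hf, hg, add_zero]
  | mul_X f j hf =>
    have hX : hamiltonianDerivation n i (X (Sum.inl j)) = 0 := by
      simp [hamiltonianDerivation_apply, pderiv_X]
    simp [hf, hX]

/-- The substitution `λᵢ ↦ -qᵢpᵢ`, an idempotent endomorphism with kernel `(qᵢpᵢ + λᵢ)ᵢ`. -/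
noncomputable def eliminateParameters (n : ℕ) :
    MvPolynomial (Fin n ⊕ (Fin n ⊕ Fin n)) ℂ →ₐ[ℂ] MvPolynomial (Fin n ⊕ (Fin n ⊕ Fin n)) ℂ :=
  aeval (Sum.elim (fun i => -(X (Sum.inr (Sum.inl i)) * X (Sum.inr (Sum.inr i))))
    (fun v => X (Sum.inr v)))

theorem eliminateParameters_hamiltonianDerivation (n : ℕ) (i : Fin n)
    (f : MvPolynomial (Fin n ⊕ (Fin n ⊕ Fin n)) ℂ) :
    eliminateParameters n (hamiltonianDerivation n i f) =
      hamiltonianDerivation n i (eliminateParameters n f) := by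
  induction f using MvPolynomial.induction_on with
  | C a => simp [eliminateParameters, algebraMap_eq, derivation_C]
  | add f g hf hg => simp only [map_add, hf, hg]
  | mul_X f v hf =>
    have hX : eliminateParameters n (hamiltonianDerivation n i (X v)) =
        hamiltonianDerivation n i (eliminateParameters n (X v)) := by
      rcases v with j | j | j <;> by_cases hj : j = i <;>
        simp [eliminateParameters, hamiltonianDerivation_apply, pderiv_X, hj,
          mul_comm]
    simp only [Derivation.leibniz, map_mul, map_add, smul_eq_mul, hf, hX]

theorem sub_eliminateParameters_mem (n : ℕ)
    (J : Ideal (MvPolynomial (Fin n ⊕ (Fin n ⊕ Fin n)) ℂ))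
    (hJ : ∀ i : Fin n,
      X (Sum.inr (Sum.inl i)) * X (Sum.inr (Sum.inr i)) + X (Sum.inl i) ∈ J)
    (f : MvPolynomial (Fin n ⊕ (Fin n ⊕ Fin n)) ℂ) : f - eliminateParameters n f ∈ J := by
  have hhom : (Ideal.Quotient.mkₐ ℂ J).comp (eliminateParameters n) =
      Ideal.Quotient.mkₐ ℂ J := by
    ext v
    refine Ideal.Quotient.eq.2 ?_
    rcases v with j | j | j
    · simpa [eliminateParameters, ← neg_add'] using J.neg_mem (hJ j)
    · simp [eliminateParameters]
    · simp [eliminateParameters]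
  exact Ideal.Quotient.eq.1 (DFunLike.congr_fun hhom f).symm

theorem mem_span_iff_eliminateParameters_eq_zero (n : ℕ)
    (f : MvPolynomial (Fin n ⊕ (Fin n ⊕ Fin n)) ℂ) :
    f ∈ Ideal.span (Set.range fun i : Fin n =>
        (X (Sum.inr (Sum.inl i)) * X (Sum.inr (Sum.inr i)) + X (Sum.inl i) :
          MvPolynomial (Fin n ⊕ (Fin n ⊕ Fin n)) ℂ)) ↔
      eliminateParameters n f = 0 := by
  constructor
  · intro hf
    refine (Ideal.span_le (I := RingHom.ker (eliminateParameters n))).2 ?_ hf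
    rintro _ ⟨i, rfl⟩
    simp [eliminateParameters]
  · intro hf
    simpa [hf] using
      sub_eliminateParameters_mem n _ (fun i => Ideal.subset_span (Set.mem_range_self i)) f

theorem exists_monomial_sub_rename_mem (n : ℕ)
    (J : Ideal (MvPolynomial (Fin n ⊕ (Fin n ⊕ Fin n)) ℂ))
    (hJ : ∀ i : Fin n,
      X (Sum.inr (Sum.inl i)) * X (Sum.inr (Sum.inr i)) + X (Sum.inl i) ∈ J)
    (m : Fin n ⊕ (Fin n ⊕ Fin n) →₀ ℕ)
    (hm : ∀ i, m (Sum.inr (Sum.inr i)) = m (Sum.inr (Sum.inl i))) (c : ℂ) :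
    ∃ b : MvPolynomial (Fin n) ℂ, monomial m c - rename Sum.inl b ∈ J := by
  refine ⟨C c * ∏ i, (X i ^ m (Sum.inl i) * (-X i) ^ m (Sum.inr (Sum.inl i))),
    Ideal.Quotient.eq.1 ?_⟩
  have hqp (i : Fin n) : Ideal.Quotient.mk J (X (Sum.inr (Sum.inl i))) *
      Ideal.Quotient.mk J (X (Sum.inr (Sum.inr i))) = -Ideal.Quotient.mk J (X (Sum.inl i)) := by
    rw [eq_neg_iff_add_eq_zero, ← map_mul, ← map_add]
    exact Ideal.Quotient.eq_zero_iff_mem.2 (hJ i)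
  rw [monomial_eq, Finsupp.prod_fintype _ _ fun _ => pow_zero _]
  simp only [Fintype.prod_sum_type, map_mul, map_prod, map_pow, map_neg, rename_C, rename_X, hm,
    ← Finset.prod_mul_distrib, ← mul_pow, ← hqp]

theorem exists_sub_rename_mem_of_support (n : ℕ)
    (J : Ideal (MvPolynomial (Fin n ⊕ (Fin n ⊕ Fin n)) ℂ))
    (hJ : ∀ i : Fin n,
      X (Sum.inr (Sum.inl i)) * X (Sum.inr (Sum.inr i)) + X (Sum.inl i) ∈ J)
    (g : MvPolynomial (Fin n ⊕ (Fin n ⊕ Fin n)) ℂ)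
    (hg : ∀ m ∈ g.support, ∀ i, m (Sum.inr (Sum.inr i)) = m (Sum.inr (Sum.inl i))) :
    ∃ b : MvPolynomial (Fin n) ℂ, g - rename Sum.inl b ∈ J := by
  choose! b hb using fun m hm =>
    exists_monomial_sub_rename_mem n J hJ m (hg m hm) (coeff m g)
  refine ⟨∑ m ∈ g.support, b m, ?_⟩
  nth_rewrite 1 [g.as_sum]
  rw [map_sum, ← Finset.sum_sub_distrib]
  exact J.sum_mem hb

/-- `H⁰` of the relative Lagrange complex of the deformation `Fᵢ = qᵢpᵢ + λᵢ`
consists of the functions pulled back from the parameter space: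
`{Fᵢ,h} ∈ J` for all `i` iff `h` agrees modulo `J = (F₁,…,Fₙ)` with a
polynomial `b` in the parameters `λ` only. -/
theorem stmt_7 (n : ℕ) (hn : 1 ≤ n)
    (F : Fin n → MvPolynomial (Fin n ⊕ (Fin n ⊕ Fin n)) ℂ)
    (hF : ∀ i : Fin n,
      F i = X (Sum.inr (Sum.inl i)) * X (Sum.inr (Sum.inr i)) + X (Sum.inl i))
    (J : Ideal (MvPolynomial (Fin n ⊕ (Fin n ⊕ Fin n)) ℂ))
    (hJ : J = Ideal.span (Set.range F))
    (h : MvPolynomial (Fin n ⊕ (Fin n ⊕ Fin n)) ℂ) :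
    (∀ i : Fin n, relPoissonBracket n (F i) h ∈ J) ↔
      ∃ b : MvPolynomial (Fin n) ℂ,
        h - rename (Sum.inl : Fin n → Fin n ⊕ (Fin n ⊕ Fin n)) b ∈ J := by
  obtain rfl : F = fun i =>
      X (Sum.inr (Sum.inl i)) * X (Sum.inr (Sum.inr i)) + X (Sum.inl i) := funext hF
  have hFJ (i : Fin n) :
      X (Sum.inr (Sum.inl i)) * X (Sum.inr (Sum.inr i)) + X (Sum.inl i) ∈ J :=
    hJ ▸ Ideal.subset_span (Set.mem_range_self i)
  have hJ0 f : f ∈ J ↔ eliminateParameters n f = 0 :=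
    hJ ▸ mem_span_iff_eliminateParameters_eq_zero n f
  simp only [relPoissonBracket_eq_hamiltonianDerivation]
  constructor
  · intro hh
    obtain ⟨b, hb⟩ := exists_sub_rename_mem_of_support n J hFJ (eliminateParameters n h) <| by
      intro m hm i
      have hi := (hJ0 _).1 (hh i)
      rw [eliminateParameters_hamiltonianDerivation] at hi
      have hc := coeff_hamiltonianDerivation n i (eliminateParameters n h) m
      rw [hi, coeff_zero, eq_comm, mul_eq_zero, or_iff_left (mem_support_iff.1 hm),
        sub_eq_zero] at hc
      exact_mod_cast hc
    exact ⟨b, by simpa using J.add_mem (sub_eliminateParameters_mem n J hFJ h) hb⟩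
  · rintro ⟨b, hb⟩ i
    rw [hJ0, map_sub, sub_eq_zero] at hb
    rw [hJ0, eliminateParameters_hamiltonianDerivation, hb,
      ← eliminateParameters_hamiltonianDerivation, hamiltonianDerivation_rename_inl, map_zero]
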